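/- If N = q · n² is an odd perfect number with q prime, q ≡ 1 (mod 4), gcd(q,n) = 1, and n < q, then σ(q)/n < √3 and hence σ(q)/n + σ(n)/q < 1 + √3. -/

import Mathlib

open Finset

theorem pred_mul_geom_sum_add_one {r : ℕ} (hr : 1 ≤ r) (n : ℕ) :
    (r - 1) * ∑ i ∈ range n, r ^ i + 1 = r ^ n := by
  obtain ⟨x, rfl⟩ := Nat.exists_eq_add_of_le' hr
  rw [Nat.add_sub_cancel, mul_comm]
  exact geom_sum_mul_add x n

theorem pow_lt_geom_sum {r k n : ℕ} (hk : 1 ≤ k) (hkn : k < n) :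
    r ^ k < ∑ i ∈ range n, r ^ i := by
  have h : ∑ i ∈ ({0, k} : Finset ℕ), r ^ i ≤ ∑ i ∈ range n, r ^ i :=
    sum_le_sum_of_subset fun i hi => by
      simp only [mem_insert, mem_singleton] at hi
      simp only [mem_range]
      omega
  rw [sum_pair (by omega), pow_zero] at h
  omega

theorem geom_sum_lt_of_lt {r s m n : ℕ} (hrs : r < s) (hn : 2 ≤ n) (hmn : m ≤ n) :
    ∑ i ∈ range m, r ^ i < ∑ i ∈ range n, s ^ i := by
  calc ∑ i ∈ range m, r ^ i ≤ ∑ i ∈ range n, r ^ i :=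
        sum_le_sum_of_subset (range_subset_range.2 hmn)
    _ < ∑ i ∈ range n, s ^ i :=
        sum_lt_sum (fun i _ => Nat.pow_le_pow_left hrs.le i)
          ⟨1, mem_range.2 (by omega), by simpa using hrs⟩

theorem two_mul_geom_sum_ge {r : ℕ} (hr : 1 ≤ r) (n : ℕ) :
    2 * n + (r - 1) * (n * (n - 1)) ≤ 2 * ∑ i ∈ range n, r ^ i := by
  obtain ⟨x, rfl⟩ := Nat.exists_eq_add_of_le' hr
  rw [Nat.add_sub_cancel]
  induction n with
  | zero => simp
  | succ n ih =>
    rw [sum_range_succ]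
    have h : 1 + n * x ≤ (x + 1) ^ n := by
      have := one_add_mul_le_pow (a := (x : ℤ)) (by linarith [Int.natCast_nonneg x]) n
      zify
      rw [add_comm (x : ℤ) 1]
      exact this
    rcases n with _ | n
    · simp
    · simp only [Nat.add_sub_cancel] at ih ⊢
      nlinarith

theorem sum_pred_le_of_odd {T : Finset ℕ} {k : ℕ} (hT : ∀ r ∈ T, Odd r ∧ 3 ≤ r ∧ r ≤ 2 * k + 1) :
    ∑ r ∈ T, (r - 1) ≤ k * (k + 1) := by
  have hsub : T ⊆ (range k).image fun i => 2 * i + 3 := by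
    intro r hr
    obtain ⟨⟨c, hc⟩, h3, hk⟩ := hT r hr
    exact mem_image.2 ⟨c - 1, mem_range.2 (by omega), by omega⟩
  have hsum : ∀ k : ℕ, ∑ i ∈ range k, (2 * i + 3 - 1) = k * (k + 1) := by
    intro k
    induction k with
    | zero => simp
    | succ k ih => rw [sum_range_succ, ih]; simp only [Nat.add_succ_sub_one]; ring
  calc ∑ r ∈ T, (r - 1) ≤ ∑ r ∈ (range k).image (fun i => 2 * i + 3), (r - 1) :=
        sum_le_sum_of_subset hsub
    _ = ∑ i ∈ range k, (2 * i + 3 - 1) :=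
        sum_image fun a _ b _ h => by simpa using h
    _ = k * (k + 1) := hsum k

theorem one_add_sum_pred_le_prod {T : Finset ℕ} (hT : ∀ r ∈ T, 1 ≤ r) :
    1 + ∑ r ∈ T, (r - 1) ≤ ∏ r ∈ T, r := by
  induction T using Finset.induction_on with
  | empty => simp
  | insert a T ha ih =>
    rw [sum_insert ha, prod_insert ha]
    have h1 := ih fun r hr => hT r (mem_insert_of_mem hr)
    have h2 := hT a (mem_insert_self a T)
    obtain ⟨x, rfl⟩ := Nat.exists_eq_add_of_le' h2
    simp only [Nat.add_sub_cancel]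
    nlinarith [Nat.zero_le (x * ∑ r ∈ T, (r - 1)), Nat.zero_le x]

theorem sum_pred_add_sq_le_prod {T : Finset ℕ} {f : ℕ} (hT : ∀ r ∈ T, f < r) (hcard : 1 < T.card) :
    ∑ r ∈ T, (r - 1) + f ^ 2 ≤ ∏ r ∈ T, r := by
  obtain ⟨a, ha, b, hb, hab⟩ := one_lt_card.1 hcard
  have hb' : b ∈ T.erase a := mem_erase.2 ⟨hab.symm, hb⟩
  rw [← add_sum_erase T _ ha, ← mul_prod_erase T _ ha, ← add_sum_erase _ _ hb',
    ← mul_prod_erase _ _ hb']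
  have h := one_add_sum_pred_le_prod (T := (T.erase a).erase b) fun r hr => by
    have := hT r (mem_of_mem_erase (mem_of_mem_erase hr)); omega
  have h1 := hT a ha
  have h2 := hT b hb
  obtain ⟨x, rfl⟩ := Nat.exists_eq_add_of_lt h1
  obtain ⟨y, rfl⟩ := Nat.exists_eq_add_of_lt h2
  generalize ∑ r ∈ (T.erase (f + x + 1)).erase (f + y + 1), (r - 1) = X at *
  generalize ∏ r ∈ (T.erase (f + x + 1)).erase (f + y + 1), r = Y at *
  simp only [Nat.add_sub_cancel]
  have : (f + x + 1) * ((f + y + 1) * (1 + X)) ≤ (f + x + 1) * ((f + y + 1) * Y) := by gcongr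
  nlinarith [Nat.zero_le (f * x), Nat.zero_le (f * y), Nat.zero_le (x * y), Nat.zero_le (f * X),
    Nat.zero_le (x * X), Nat.zero_le (y * X), Nat.zero_le ((f + x) * (f + y) * X)]

theorem geom_sum_ne_of_small {s t f e : ℕ} (hs : s.Prime) (ht : t.Prime) (hf : f.Prime)
    (he : e.Prime) (h2 : 2 < s) (hst : s < t) (h3 : 3 ≤ e) (h3f : 3 ≤ f) (htf : t ≤ 72)
    (hf72 : f ≤ 72) (he72 : e ≤ 72) : ∑ i ∈ range f, s ^ i ≠ ∑ i ∈ range e, t ^ i := by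
  intro h
  set P : List ℕ := [3, 5, 7, 11, 13, 17, 19, 23, 29, 31, 37, 41, 43, 47, 53, 59, 61, 67, 71]
    with hP
  have hmem : ∀ x : ℕ, x.Prime → 3 ≤ x → x ≤ 72 → x ∈ P := by
    intro x hx h3 h72
    interval_cases x <;> first | (simp [hP]; done) | (exfalso; revert hx; norm_num)
  have hall : P.all (fun s => P.all fun t => decide (t ≤ s) || P.all fun f => P.all fun e =>
      ((s ^ f - 1) * (t - 1) != (t ^ e - 1) * (s - 1))) = true := by
    rw [hP]; decide +kernel
  have h1 := pred_mul_geom_sum_add_one hs.one_le f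
  have h4 := pred_mul_geom_sum_add_one ht.one_le e
  simp only [List.all_eq_true] at hall
  have h5 := hall s (hmem s hs (by omega) (by omega)) t (hmem t ht (by omega) htf)
  rw [Bool.or_eq_true] at h5
  rcases h5 with h5 | h5
  · have := of_decide_eq_true h5
    omega
  · simp only [List.all_eq_true] at h5
    have h6 := h5 f (hmem f hf h3f hf72) e (hmem e he h3 he72)
    simp only [bne_iff_ne, ne_eq] at h6
    apply h6
    rw [← h1, ← h4, h]
    simp only [Nat.add_sub_cancel]
    ring

theorem pow_five_lt_three_pow {f : ℕ} (hf : 13 ≤ f) : f ^ 5 < 2 * 3 ^ (f - 1) := by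
  induction f, hf using Nat.le_induction with
  | base => norm_num
  | succ n hn ih =>
    rw [show n + 1 - 1 = (n - 1) + 1 by omega, pow_succ 3]
    have h : (13 * (n + 1)) ^ 5 ≤ (14 * n) ^ 5 := Nat.pow_le_pow_left (by omega) 5
    rw [mul_pow, mul_pow] at h
    omega

theorem pow_thirtyfive_le_nine_pow {f : ℕ} (hf : 73 ≤ f) : f ^ 35 ≤ 9 ^ (f - 1) := by
  induction f, hf using Nat.le_induction with
  | base => norm_num
  | succ n hn ih =>
    rw [show n + 1 - 1 = (n - 1) + 1 by omega, pow_succ 9]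
    have h : (73 * (n + 1)) ^ 35 ≤ (74 * n) ^ 35 := Nat.pow_le_pow_left (by omega) 35
    rw [mul_pow, mul_pow] at h
    have h2 : 74 ^ 35 ≤ 9 * 73 ^ 35 := by norm_num
    have h3 : 73 ^ 35 * (n + 1) ^ 35 ≤ 73 ^ 35 * (9 * n ^ 35) := by
      calc _ ≤ _ := h
        _ ≤ 9 * 73 ^ 35 * n ^ 35 := Nat.mul_le_mul_right _ h2
        _ = _ := by ring
    have h4 := Nat.le_of_mul_le_mul_left h3 (by positivity)
    omega

theorem sum_mul_erase_le (ℓ : ℕ → ℕ) (S : Finset ℕ) :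
    ∑ r ∈ S, (r - 1) * ((ℓ r - 1) * ∏ t ∈ S.erase r, ℓ t) ≤
      (∏ r ∈ S, ℓ r) * ∑ r ∈ S, (r - 1) := by
  rw [mul_sum]
  refine sum_le_sum fun r hr => ?_
  rw [mul_comm, ← mul_prod_erase S ℓ hr]
  gcongr
  omega

/-- A set of odd primes `r`, each with an odd prime length `ℓ r` dividing `p - 1`, such that `p` is
the repunit of length `ℓ r` in base `r`. -/
structure RepunitFamily (p : ℕ) (ℓ : ℕ → ℕ) (S : Finset ℕ) : Prop where
  odd : Odd p
  prime : ∀ r ∈ S, r.Prime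
  three_le : ∀ r ∈ S, 3 ≤ r
  len_prime : ∀ r ∈ S, (ℓ r).Prime
  three_le_len : ∀ r ∈ S, 3 ≤ ℓ r
  sum_eq : ∀ r ∈ S, ∑ i ∈ range (ℓ r), r ^ i = p
  len_dvd : ∀ r ∈ S, ℓ r ∣ p - 1

namespace RepunitFamily

variable {p : ℕ} {ℓ : ℕ → ℕ} {S : Finset ℕ}

theorem len_lt_len (h : RepunitFamily p ℓ S) {r t : ℕ} (hr : r ∈ S) (ht : t ∈ S) (hrt : r < t) :
    ℓ t < ℓ r := by
  by_contra! hle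
  have h1 := geom_sum_lt_of_lt hrt (by have := h.three_le_len t ht; omega) hle
  rw [h.sum_eq r hr, h.sum_eq t ht] at h1
  exact h1.false

theorem len_injOn (h : RepunitFamily p ℓ S) : Set.InjOn ℓ S := by
  intro a ha b hb hab
  rcases lt_trichotomy a b with hlt | heq | hlt
  · exact absurd hab (h.len_lt_len ha hb hlt).ne'
  · exact heq
  · exact absurd hab (h.len_lt_len hb ha hlt).ne

theorem base_dvd (h : RepunitFamily p ℓ S) {r : ℕ} (hr : r ∈ S) : r ∣ p - 1 := by
  obtain ⟨k, hk⟩ := Nat.exists_eq_add_of_le' (h.three_le_len r hr)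
  rw [← h.sum_eq r hr, hk, sum_range_succ', pow_zero, Nat.add_sub_cancel]
  exact dvd_sum fun i _ => dvd_pow_self r i.succ_ne_zero

theorem pow_lt (h : RepunitFamily p ℓ S) {r : ℕ} (hr : r ∈ S) : r ^ (ℓ r - 1) < p := by
  have := h.three_le_len r hr
  rw [← h.sum_eq r hr]
  exact pow_lt_geom_sum (by omega) (by omega)

theorem odd_base (h : RepunitFamily p ℓ S) {r : ℕ} (hr : r ∈ S) : Odd r :=
  (h.prime r hr).odd_of_ne_two (by have := h.three_le r hr; omega)

theorem odd_len (h : RepunitFamily p ℓ S) {r : ℕ} (hr : r ∈ S) : Odd (ℓ r) :=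
  (h.len_prime r hr).odd_of_ne_two (by have := h.three_le_len r hr; omega)

theorem two_mul_prod_lt (h : RepunitFamily p ℓ S) {f : ℕ} (hne : S.Nonempty)
    (hf : ∀ r ∈ S, ℓ r ≤ f) {B : Finset ℕ} (hBS : B ⊆ S) (hB : ∀ r ∈ B, f < r) :
    2 * (∏ r ∈ S, ℓ r) * ∏ r ∈ B, r < p := by
  have hd : ∏ x ∈ insert 2 (S.image ℓ ∪ B), x ∣ p - 1 := by
    refine prod_primes_dvd _ (fun x hx => ?_) fun x hx => ?_
    all_goals
      simp only [mem_insert, mem_union, mem_image] at hx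
      rcases hx with rfl | ⟨r, hr, rfl⟩ | hx
    · exact Nat.prime_two.prime
    · exact (h.len_prime r hr).prime
    · exact (h.prime x (hBS hx)).prime
    · have := h.odd
      obtain ⟨c, rfl⟩ := this
      simp
    · exact h.len_dvd r hr
    · exact h.base_dvd (hBS hx)
  have h2 : 2 ∉ S.image ℓ ∪ B := by
    simp only [mem_union, mem_image, not_or, not_exists, not_and]
    exact ⟨fun r hr => by have := h.three_le_len r hr; omega,
      fun hx => by have := h.three_le 2 (hBS hx); omega⟩
  have hdisj : Disjoint (S.image ℓ) B := by
    rw [disjoint_left]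
    intro x hx hxB
    obtain ⟨r, hr, rfl⟩ := mem_image.1 hx
    have := hf r hr
    have := hB _ hxB
    omega
  rw [prod_insert h2, prod_union hdisj, prod_image h.len_injOn, ← mul_assoc] at hd
  obtain ⟨r, hr⟩ := hne
  have h1 := h.pow_lt hr
  have h3 := Nat.one_le_pow (ℓ r - 1) r (by have := h.three_le r hr; omega)
  have := Nat.le_of_dvd (by omega) hd
  omega

theorem two_mul_lt_of_one_lt_card (h : RepunitFamily p ℓ S) {s m : ℕ} (hs : s ∈ S)
    (hmin : ∀ r ∈ S, s ≤ r) (hm : m ∈ S) (hmax : ∀ r ∈ S, r ≤ m)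
    (hW : p + ∏ r ∈ S, ℓ r ≤ 2 * ∑ r ∈ S, (r - 1) * ((ℓ r - 1) * ∏ t ∈ S.erase r, ℓ t)) :
    2 * p < (∏ r ∈ S, ℓ r) * ((ℓ m + 1) * (ℓ s ^ 2 - 1)) ∧ ∀ r ∈ S.erase m, r ≤ ℓ s := by
  have hlen : ∀ r ∈ S, ℓ r ≤ ℓ s := fun r hr => by
    rcases (hmin r hr).eq_or_lt with rfl | hlt
    · exact le_rfl
    · exact (h.len_lt_len hs hr hlt).le
  have hL : 0 < ∏ r ∈ S, ℓ r := prod_pos fun r hr => (h.len_prime r hr).pos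
  have hWL := sum_mul_erase_le ℓ S
  obtain ⟨k, hk⟩ := h.odd_len hs
  have hksq : ℓ s ^ 2 - 1 = 4 * (k * (k + 1)) := by
    rw [hk, Nat.sub_eq_iff_eq_add (Nat.one_le_pow _ _ (by omega))]; ring
  have hothers : ∀ r ∈ S.erase m, r ≤ ℓ s := by
    intro r hr
    by_contra! hlt
    obtain ⟨hrm, hrS⟩ := mem_erase.1 hr
    set B := S.filter (ℓ s < ·) with hB
    have hBcard : 1 < B.card := one_lt_card.2
      ⟨r, mem_filter.2 ⟨hrS, hlt⟩, m, mem_filter.2 ⟨hm, hlt.trans_le (hmax r hrS)⟩, hrm⟩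
    have h1 : ∑ r ∈ B, (r - 1) + ℓ s ^ 2 ≤ ∏ r ∈ B, r :=
      sum_pred_add_sq_le_prod (fun x hx => (mem_filter.1 hx).2) hBcard
    have h2 : 2 * (∏ r ∈ S, ℓ r) * ∏ r ∈ B, r < p :=
      h.two_mul_prod_lt ⟨s, hs⟩ hlen (filter_subset (ℓ s < ·) S) fun x hx => (mem_filter.1 hx).2
    have h3 : ∑ r ∈ S.filter (¬ ℓ s < ·), (r - 1) ≤ k * (k + 1) :=
      sum_pred_le_of_odd fun x hx => by
        obtain ⟨hx, hx'⟩ := mem_filter.1 hx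
        exact ⟨h.odd_base hx, h.three_le x hx, by omega⟩
    have h4 : ∑ r ∈ B, (r - 1) + ∑ r ∈ S.filter (¬ ℓ s < ·), (r - 1) = ∑ r ∈ S, (r - 1) :=
      sum_filter_add_sum_filter_not S (ℓ s < ·) fun r => r - 1
    have h5 : ∑ r ∈ S, (r - 1) ≤ ∏ r ∈ B, r := by
      have : 0 < ℓ s ^ 2 := pow_pos (by omega) 2
      omega
    have h6 := Nat.mul_le_mul_left (∏ r ∈ S, ℓ r) h5
    rw [mul_assoc] at h2
    omega
  refine ⟨?_, hothers⟩
  have hR2 : ∑ r ∈ S.erase m, (r - 1) ≤ k * (k + 1) :=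
    sum_pred_le_of_odd fun x hx => by
      have hxS := mem_of_mem_erase hx
      exact ⟨h.odd_base hxS, h.three_le x hxS, by have := hothers x hx; omega⟩
  have hsplit := add_sum_erase S (fun r => r - 1) hm
  have hR : ∑ r ∈ S, (r - 1) ≤ (ℓ m + 1) * (k * (k + 1)) := by
    by_cases hmf : m ≤ ℓ s
    · have : ∑ r ∈ S, (r - 1) ≤ k * (k + 1) :=
        sum_pred_le_of_odd fun x hx =>
          ⟨h.odd_base hx, h.three_le x hx, by have := hmax x hx; omega⟩
      nlinarith [Nat.zero_le (ℓ m * (k * (k + 1)))]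
    · have h2 := h.two_mul_prod_lt ⟨s, hs⟩ hlen (singleton_subset_iff.2 hm)
        fun x hx => by rw [mem_singleton.1 hx]; omega
      rw [prod_singleton] at h2
      rw [← add_sum_erase S _ hm] at hW
      have hrest : ∑ r ∈ S.erase m, (r - 1) * ((ℓ r - 1) * ∏ t ∈ S.erase r, ℓ t) ≤
          (∏ r ∈ S, ℓ r) * ∑ r ∈ S.erase m, (r - 1) := by
        rw [mul_sum]
        refine sum_le_sum fun r hr => ?_
        rw [mul_comm, ← mul_prod_erase S ℓ (mem_of_mem_erase hr)]
        gcongr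
        omega
      have hprod := mul_prod_erase S ℓ hm
      obtain ⟨e, he⟩ := Nat.exists_eq_add_of_le' (h.len_prime m hm).one_le
      obtain ⟨x, hx⟩ := Nat.exists_eq_add_of_le' (h.prime m hm).one_le
      generalize ∑ r ∈ S.erase m, (r - 1) = R2 at *
      generalize ∏ t ∈ S.erase m, ℓ t = L' at *
      generalize ∏ r ∈ S, ℓ r = L at *
      have hx' : m - 1 = x := by omega
      have he' : ℓ m - 1 = e := by omega
      rw [hx', he'] at hW
      rw [hx'] at hsplit
      rw [hx] at h2
      rw [he] at hprod ⊢
      have key : L * x < L * ((e + 1) * R2) := by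
        have h7 : p + L ≤ 2 * (x * (e * L') + L * R2) := by omega
        have h8 : (e + 1) * (2 * L * (x + 1) + L) ≤ (e + 1) * (2 * (x * (e * L') + L * R2)) :=
          Nat.mul_le_mul_left _ (by omega)
        have h9 : (e + 1) * (x * (e * L')) = x * e * L := by rw [← hprod]; ring
        nlinarith [Nat.zero_le (e * L), Nat.zero_le (e * L * x)]
      have := Nat.lt_of_mul_lt_mul_left key
      have h10 : (e + 2) * R2 ≤ (e + 2) * (k * (k + 1)) := Nat.mul_le_mul_left _ hR2
      rw [show e + 1 + 1 = e + 2 from rfl]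
      nlinarith
  rw [hksq]
  have := Nat.mul_le_mul_left (∏ r ∈ S, ℓ r) hR
  nlinarith

theorem len_add_two_le (h : RepunitFamily p ℓ S) {r t : ℕ} (hr : r ∈ S) (ht : t ∈ S)
    (hrt : r < t) : ℓ t + 2 ≤ ℓ r := by
  have h1 := h.len_lt_len hr ht hrt
  obtain ⟨a, ha⟩ := h.odd_len hr
  obtain ⟨b, hb⟩ := h.odd_len ht
  omega

theorem two_mul_sum_lt_singleton {r : ℕ} (h : RepunitFamily p ℓ {r}) :
    2 * ((r - 1) * (ℓ r - 1)) < p + ℓ r := by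
  have hr := mem_singleton_self r
  have h1 := two_mul_geom_sum_ge (h.prime r hr).one_le (ℓ r)
  rw [h.sum_eq r hr] at h1
  obtain ⟨x, hx⟩ := Nat.exists_eq_add_of_le' (h.three_le r hr)
  have hx' : r - 1 = x + 2 := by omega
  rw [hx'] at h1 ⊢
  obtain ⟨k, hk⟩ := h.odd_len hr
  have h3 := h.three_le_len r hr
  by_cases hk1 : k = 1
  · have h4 := h.sum_eq r hr
    rw [hk, hk1, hx] at h4
    norm_num [sum_range_succ] at h4
    rw [hk, hk1]
    norm_num
    nlinarith
  · obtain ⟨j, rfl⟩ := Nat.exists_eq_add_of_le' (show 2 ≤ k by omega)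
    rw [hk] at h1 ⊢
    simp only [Nat.add_sub_cancel] at h1 ⊢
    nlinarith [Nat.zero_le (x * j), Nat.zero_le (x * j * j), Nat.zero_le (j * j)]

theorem not_two_mul_lt_pair (h : RepunitFamily p ℓ S) {s r : ℕ} (hs : s ∈ S) (hr : r ∈ S)
    (hsr : s < r) : ¬ 2 * p < ℓ s * ℓ r * ((ℓ r + 1) * (ℓ s ^ 2 - 1)) := by
  intro hp
  have h1 := h.len_add_two_le hs hr hsr
  have h2 := h.pow_lt hs
  have h3 := h.three_le_len r hr
  have hs3 := h.three_le s hs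
  have hsp := h.sum_eq s hs
  have hrp := h.sum_eq r hr
  have hsl := h.len_prime s hs
  have hrl := h.len_prime r hr
  generalize ℓ s = f at *
  generalize ℓ r = e at *
  have h4 : 3 ^ (f - 1) ≤ s ^ (f - 1) := Nat.pow_le_pow_left hs3 _
  by_cases hf : 13 ≤ f
  · have h5 := pow_five_lt_three_pow hf
    have h6 : f * e * ((e + 1) * (f ^ 2 - 1)) ≤ f * f * (f * f ^ 2) := by
      gcongr <;> omega
    nlinarith
  · have hf5 : 5 ≤ f := by omega
    interval_cases f
    all_goals first | (exfalso; revert hsl; norm_num; done) | skip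
    · have he : e = 3 := by omega
      subst he
      norm_num at hp h2
      have : s < 6 := lt_of_pow_lt_pow_left₀ 4 (by norm_num) (by omega : s ^ 4 < 6 ^ 4)
      have : r < 30 := by
        simp only [sum_range_succ, sum_range_zero] at hrp
        nlinarith
      subst hsp
      interval_cases s <;> interval_cases r <;> revert hrp hp <;> decide
    · have he : e = 3 ∨ e = 5 := by
        have : e ≤ 5 := by omega
        interval_cases e
        · simp
        · exact absurd hrl (by norm_num)
        · simp
      have hp' : p < 5040 := by rcases he with rfl | rfl <;> norm_num at hp <;> omega
      have : s < 5 := by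
        refine lt_of_pow_lt_pow_left₀ 6 (by norm_num) (?_ : s ^ 6 < 5 ^ 6)
        norm_num at h2 ⊢
        omega
      have : r < 72 := by
        rcases he with rfl | rfl <;> simp only [sum_range_succ, sum_range_zero] at hrp
        · nlinarith
        · nlinarith [Nat.zero_le (r ^ 3), Nat.zero_le (r ^ 4)]
      subst hsp
      interval_cases s <;> rcases he with rfl | rfl <;> interval_cases r <;>
        revert hrp hp' <;> decide
    · have he : e ≤ 7 := by
        have : e ≤ 9 := by omega
        interval_cases e <;> first | omega | (exfalso; revert hrl; norm_num)
      have h6 : 11 * e * ((e + 1) * (11 ^ 2 - 1)) ≤ 11 * 7 * ((7 + 1) * (11 ^ 2 - 1)) := by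
        gcongr
      norm_num at h6 h4 h2 hp
      omega

theorem two_mul_prod_len_le (h : RepunitFamily p ℓ S) {T : Finset ℕ} (hTS : T ⊆ S) {v : ℕ}
    (hv : ∀ r ∈ T, ℓ r ≤ v) (h2v : 2 ≤ v) : 2 * ∏ r ∈ T, ℓ r ≤ 4 ^ v := by
  refine le_trans ?_ (primorial_le_four_pow v)
  have h2 : 2 ∉ T.image ℓ := by
    simp only [mem_image, not_exists, not_and]
    exact fun r hr => by have := h.three_le_len r (hTS hr); omega
  rw [← prod_image (f := fun x => x) (h.len_injOn.mono (coe_subset.2 hTS)),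
    ← prod_insert (f := fun x => x) h2, primorial]
  refine prod_le_prod_of_subset_of_one_le' (fun x hx => ?_) fun x hx _ =>
    (mem_filter.1 hx).2.one_le
  rw [mem_filter, mem_range]
  rcases mem_insert.1 hx with rfl | hx
  · exact ⟨by omega, Nat.prime_two⟩
  · obtain ⟨r, hr, rfl⟩ := mem_image.1 hx
    exact ⟨by have := hv r hr; omega, h.len_prime r (hTS hr)⟩

theorem not_two_mul_lt_triple (h : RepunitFamily p ℓ S) {s t u m : ℕ} (hs : s ∈ S) (ht : t ∈ S)
    (hu : u ∈ S) (hm : m ∈ S) (hst : s < t) (htu : t < u) (hmax : ∀ r ∈ S, r ≤ m)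
    (hT : ∀ r ∈ (S.erase s).erase t, u ≤ r) (htf : t ≤ ℓ s) :
    ¬ 2 * p < (∏ r ∈ S, ℓ r) * ((ℓ m + 1) * (ℓ s ^ 2 - 1)) := by
  intro hp
  have h1 := h.len_add_two_le hs ht hst
  have h2 := h.len_add_two_le ht hu htu
  by_cases hf : ℓ s ≤ 72
  · exact geom_sum_ne_of_small (h.prime s hs) (h.prime t ht) (h.len_prime s hs) (h.len_prime t ht)
      (h.three_le s hs) hst (h.three_le_len t ht) (h.three_le_len s hs) (htf.trans hf) hf (by omega)
      ((h.sum_eq s hs).trans (h.sum_eq t ht).symm)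
  have len_anti : ∀ r ∈ S, u ≤ r → ℓ r ≤ ℓ u := fun r hr hur => by
    rcases hur.eq_or_lt with rfl | hlt
    · exact le_rfl
    · exact (h.len_lt_len hu hr hlt).le
  have h3 := h.two_mul_prod_len_le (T := (S.erase s).erase t)
    ((erase_subset _ _).trans (erase_subset _ _)) (v := ℓ u)
    (fun r hr => len_anti r (mem_of_mem_erase (mem_of_mem_erase hr)) (hT r hr))
    (h.len_prime u hu).two_le
  have h4 := len_anti m hm (hmax u hu)
  rw [← mul_prod_erase S ℓ hs, ← mul_prod_erase _ ℓ (mem_erase.2 ⟨hst.ne', ht⟩)] at hp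
  have hu7 : 7 ≤ u := by
    have := h.three_le s hs
    obtain ⟨a, ha⟩ := h.odd_base hs
    obtain ⟨b, hb⟩ := h.odd_base ht
    obtain ⟨c, hc⟩ := h.odd_base hu
    omega
  have h7 : 7 ^ (ℓ u - 1) ≤ p := (Nat.pow_le_pow_left hu7 _).trans (h.pow_lt hu).le
  have h9 : 3 ^ (ℓ s - 1) ≤ p := (Nat.pow_le_pow_left (h.three_le s hs) _).trans (h.pow_lt hs).le
  have hv1 := (h.len_prime u hu).one_le
  have hp0 : 0 < p := lt_of_lt_of_le (by positivity) h7
  generalize ∏ r ∈ (S.erase s).erase t, ℓ r = X at *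
  generalize ℓ s = f at *
  generalize ℓ t = g at *
  generalize ℓ u = v at *
  generalize ℓ m = e at *
  have h10 : 4 * p < f ^ 5 * 4 ^ v := by
    calc 4 * p < 2 * (f * (g * X) * ((e + 1) * (f ^ 2 - 1))) := by omega
      _ = f * (g * (2 * X)) * ((e + 1) * (f ^ 2 - 1)) := by ring
      _ ≤ f * (f * 4 ^ v) * (f * f ^ 2) := by
        gcongr <;> omega
      _ = f ^ 5 * 4 ^ v := by ring
  obtain ⟨w, rfl⟩ := Nat.exists_eq_add_of_le' hv1
  rw [Nat.add_sub_cancel] at h7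
  have h11 : p < f ^ 5 * 4 ^ w := by
    rw [pow_succ 4, ← mul_assoc] at h10
    omega
  have h12 : p ^ 7 < f ^ 35 * p ^ 5 := by
    calc p ^ 7 < (f ^ 5 * 4 ^ w) ^ 7 := Nat.pow_lt_pow_left h11 (by norm_num)
      _ = f ^ 35 * (4 ^ 7) ^ w := by rw [mul_pow, ← pow_mul, ← pow_mul, ← pow_mul, mul_comm w 7]
      _ ≤ f ^ 35 * (7 ^ 5) ^ w :=
        Nat.mul_le_mul_left _ (Nat.pow_le_pow_left (by norm_num) w)
      _ = f ^ 35 * (7 ^ w) ^ 5 := by rw [← pow_mul, ← pow_mul, mul_comm w 5]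
      _ ≤ f ^ 35 * p ^ 5 := by gcongr
  have h13 : p ^ 2 < f ^ 35 := by
    refine Nat.lt_of_mul_lt_mul_right (a := p ^ 5) ?_
    rwa [← pow_add]
  have h14 : 9 ^ (f - 1) ≤ p ^ 2 := by
    rw [show 9 = 3 ^ 2 by norm_num, ← pow_mul, mul_comm, pow_mul]
    gcongr
  have := pow_thirtyfive_le_nine_pow (f := f) (by omega)
  omega

theorem two_mul_sum_lt (h : RepunitFamily p ℓ S) (hne : S.Nonempty) :
    2 * ∑ r ∈ S, (r - 1) * ((ℓ r - 1) * ∏ t ∈ S.erase r, ℓ t) < p + ∏ r ∈ S, ℓ r := by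
  by_contra! hW
  set s := S.min' hne
  set m := S.max' hne
  have hs : s ∈ S := S.min'_mem hne
  have hm : m ∈ S := S.max'_mem hne
  have hmin : ∀ r ∈ S, s ≤ r := fun r hr => S.min'_le r hr
  have hmax : ∀ r ∈ S, r ≤ m := fun r hr => S.le_max' r hr
  rcases (hmin m hm).eq_or_lt with hsm | hsm
  · have hS : S = {s} := eq_singleton_iff_unique_mem.2
      ⟨hs, fun r hr => le_antisymm ((hmax r hr).trans hsm.ge) (hmin r hr)⟩
    clear_value s m
    subst hS
    have := h.two_mul_sum_lt_singleton
    simp only [sum_singleton, prod_singleton, erase_singleton, prod_empty, mul_one] at hW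
    omega
  obtain ⟨hp, hle⟩ := h.two_mul_lt_of_one_lt_card hs hmin hm hmax hW
  clear_value s m
  have hne1 : (S.erase s).Nonempty := ⟨m, mem_erase.2 ⟨hsm.ne', hm⟩⟩
  set t := (S.erase s).min' hne1
  have ht' : t ∈ S.erase s := min'_mem _ _
  obtain ⟨hts, ht⟩ := mem_erase.1 ht'
  have hst : s < t := lt_of_le_of_ne (hmin t ht) hts.symm
  have htmin : ∀ r ∈ S.erase s, t ≤ r := fun r hr => min'_le _ r hr
  clear_value t
  by_cases hne2 : ((S.erase s).erase t).Nonempty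
  · set u := ((S.erase s).erase t).min' hne2
    have hu' : u ∈ (S.erase s).erase t := min'_mem _ _
    obtain ⟨hut, hus⟩ := mem_erase.1 hu'
    have htu : t < u := lt_of_le_of_ne (htmin u hus) hut.symm
    have hu := mem_of_mem_erase hus
    have hum := hmax u hu
    exact h.not_two_mul_lt_triple hs ht hu hm hst htu hmax (fun r hr => min'_le _ r hr)
      (hle t (mem_erase.2 ⟨by omega, ht⟩)) hp
  · have hempty := not_nonempty_iff_eq_empty.1 hne2
    have htm : m = t := by
      by_contra hmt
      exact hne2 ⟨m, mem_erase.2 ⟨hmt, mem_erase.2 ⟨hsm.ne', hm⟩⟩⟩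
    subst htm
    rw [← mul_prod_erase S ℓ hs, ← mul_prod_erase _ ℓ ht', hempty, prod_empty, mul_one] at hp
    exact h.not_two_mul_lt_pair hs hm hsm hp

end RepunitFamily

theorem geom_sum_mul_eq {r : ℕ} (a b : ℕ) :
    ∑ i ∈ range (a * b), r ^ i = (∑ i ∈ range a, r ^ i) * ∑ i ∈ range b, (r ^ a) ^ i := by
  induction b with
  | zero => simp
  | succ b ih =>
    rw [Nat.mul_succ, sum_range_add, ih, sum_range_succ _ b, mul_add]
    simp only [pow_add, ← mul_sum, pow_mul]
    ring

theorem pow_pred_eq_one_of_geom_sum_eq_pow {p r n j : ℕ} (hp : p.Prime) (hp2 : Odd p)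
    (hr : 2 ≤ r) (hn : 1 ≤ n) (hj : 2 ≤ j) (h : ∑ i ∈ range n, r ^ i = p ^ j) :
    (r : ZMod (p ^ 2)) ^ (p - 1) = 1 := by
  have hpow := pred_mul_geom_sum_add_one (r := r) (by omega) n
  rw [h] at hpow
  have hr1 : (r : ZMod (p ^ 2)) ^ n = 1 := by
    have h0 : ((p ^ j : ℕ) : ZMod (p ^ 2)) = 0 :=
      (ZMod.natCast_eq_zero_iff _ _).2 (pow_dvd_pow p hj)
    rw [← Nat.cast_pow, ← hpow, Nat.cast_add, Nat.cast_mul, h0, mul_zero, zero_add, Nat.cast_one]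
  have hpn : ¬ p ∣ n := by
    rintro ⟨a, rfl⟩
    rw [mul_comm, geom_sum_mul_eq] at h
    have ha : 1 ≤ a := Nat.pos_of_ne_zero (by rintro rfl; simp at hn)
    have hy : 2 ≤ r ^ a := hr.trans (Nat.le_self_pow (by omega) r)
    have hlt : p < ∑ i ∈ range p, (r ^ a) ^ i := by
      have := geom_sum_lt_of_lt (r := 1) (s := r ^ a) (m := p) (n := p) (by omega) hp.two_le le_rfl
      simpa using this
    obtain ⟨k, -, hk⟩ := (Nat.dvd_prime_pow hp).1 (Dvd.intro_left _ h)
    have hk2 : 2 ≤ k := by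
      by_contra! hk2
      have := Nat.pow_le_pow_right hp.pos (show k ≤ 1 by omega)
      rw [pow_one] at this
      omega
    have hmod : (p : ℤ) ∣ (r : ℤ) ^ a - 1 := by
      have : Fact p.Prime := ⟨hp⟩
      rw [← ZMod.intCast_zmod_eq_zero_iff_dvd]
      have h0 : ((p ^ j : ℕ) : ZMod p) = 0 :=
        (ZMod.natCast_eq_zero_iff _ _).2 (dvd_pow_self p (by omega))
      have h1 := congrArg (Nat.cast : ℕ → ZMod p) hpow
      rw [Nat.cast_add, Nat.cast_mul, h0, mul_zero, zero_add, Nat.cast_one, mul_comm,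
        pow_mul, Nat.cast_pow, ZMod.pow_card] at h1
      push_cast at h1 ⊢
      rw [← h1, sub_self]
    obtain ⟨z, hz⟩ := hmod
    have hz' : (r : ℤ) ^ a = 1 + p * z := by linarith
    have hodd := odd_sq_dvd_geom_sum₂_sub (a := (1 : ℤ)) z hp2
    simp only [one_pow, mul_one] at hodd
    rw [← hz'] at hodd
    have hk' : ∑ i ∈ range p, ((r : ℤ) ^ a) ^ i = (p : ℤ) ^ k := by exact_mod_cast hk
    rw [hk'] at hodd
    have h3 : (p : ℤ) ^ 2 ∣ p := by
      have := dvd_sub (pow_dvd_pow (p : ℤ) hk2) hodd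
      simpa using this
    have h4 : p ^ 2 ∣ p := by exact_mod_cast h3
    have := Nat.le_of_dvd hp.pos h4
    nlinarith [hp.two_le]
  have hcop : r.Coprime (p ^ 2) := by
    refine (Nat.Coprime.pow_right 2 ?_)
    refine (Nat.Prime.coprime_iff_not_dvd hp |>.2 fun hd => ?_).symm
    have h5 : p ∣ r ^ n := dvd_pow hd (by omega)
    rw [← hpow] at h5
    have h6 := (Nat.dvd_add_right
      (Dvd.dvd.mul_left (dvd_pow_self p (by omega : j ≠ 0)) (r - 1))).1 h5
    exact hp.one_lt.ne' (Nat.dvd_one.1 h6)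
  have htot : (r : ZMod (p ^ 2)) ^ (p * (p - 1)) = 1 := by
    have := ZMod.pow_totient (ZMod.unitOfCoprime r hcop)
    rw [Nat.totient_prime_pow hp (by norm_num)] at this
    simpa [Units.ext_iff] using this
  have h7 := orderOf_dvd_of_pow_eq_one hr1
  have h8 := orderOf_dvd_of_pow_eq_one htot
  refine orderOf_dvd_iff_pow_eq_one.1 (Nat.Coprime.dvd_of_dvd_mul_left ?_ h8)
  exact Nat.Coprime.coprime_dvd_left h7 ((Nat.Prime.coprime_iff_not_dvd hp).2 hpn).symm

theorem prime_of_geom_sum_prime {p r n : ℕ} (hp : p.Prime) (hr : 2 ≤ r) (hn : 2 ≤ n)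
    (h : ∑ i ∈ range n, r ^ i = p) : n.Prime := by
  rw [Nat.prime_def]
  refine ⟨hn, fun d hd => ?_⟩
  by_contra! hne
  obtain ⟨e, rfl⟩ := hd
  have hd0 : d ≠ 0 := by rintro rfl; simp at hn
  have he1 : 2 ≤ e := by
    rcases e with _ | _ | e
    · simp at hn
    · simp at hne
    · omega
  rw [geom_sum_mul_eq] at h
  have h1 := pow_lt_geom_sum (r := r) (k := 1) (n := d) le_rfl (by omega)
  have h2 := pow_lt_geom_sum (r := r ^ d) (k := 1) (n := e) le_rfl (by omega)
  have h3 : 1 ≤ r ^ d := Nat.one_le_pow _ _ (by omega)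
  rw [pow_one] at h1 h2
  exact Nat.not_prime_mul (by omega) (by omega) (h ▸ hp)

theorem dvd_pred_of_geom_sum_prime {p r n : ℕ} (hp : p.Prime) (hr : 2 ≤ r) (hn : 2 ≤ n)
    (h : ∑ i ∈ range n, r ^ i = p) : n ∣ p - 1 := by
  have : Fact p.Prime := ⟨hp⟩
  have : Fact n.Prime := ⟨prime_of_geom_sum_prime hp hr hn h⟩
  have hrp := pow_lt_geom_sum (r := r) (k := 1) (n := n) le_rfl (by omega)
  rw [h, pow_one] at hrp
  have hpow := pred_mul_geom_sum_add_one (r := r) (by omega) n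
  rw [h] at hpow
  have h1 : (r : ZMod p) ^ n = 1 := by
    rw [← Nat.cast_pow, ← hpow]
    simp
  have h2 : (r : ZMod p) ≠ 1 := by
    intro h2
    have h3 : ((r : ℕ) : ZMod p) = ((1 : ℕ) : ZMod p) := by simpa using h2
    rw [ZMod.natCast_eq_natCast_iff', Nat.mod_eq_of_lt hrp, Nat.mod_eq_of_lt hp.one_lt] at h3
    omega
  have h0 : (r : ZMod p) ≠ 0 := by
    intro h0
    rw [h0, zero_pow (by omega)] at h1
    exact zero_ne_one h1
  rw [← orderOf_eq_prime h1 h2]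
  exact ZMod.orderOf_dvd_card_sub_one h0

theorem add_mul_pow_of_sq_eq_zero {R : Type*} [CommRing R] {ε : R} (hε : ε ^ 2 = 0) (x y : R)
    (k : ℕ) : (x + ε * y) ^ k = x ^ k + k * x ^ (k - 1) * (ε * y) := by
  obtain ⟨c, hc⟩ := Polynomial.powAddExpansion x (ε * y) k
  rw [hc, mul_pow, hε]
  ring

theorem prod_one_add_mul_of_sq_eq_zero {R ι : Type*} [CommRing R] {ε : R} (hε : ε ^ 2 = 0)
    (s : Finset ι) (τ : ι → R) : ∏ i ∈ s, (1 + ε * τ i) = 1 + ε * ∑ i ∈ s, τ i := by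
  classical
  induction s using Finset.induction_on with
  | empty => simp
  | insert a s ha ih =>
    rw [prod_insert ha, sum_insert ha, ih]
    linear_combination (τ a * ∑ i ∈ s, τ i) * hε

theorem natCast_self_sq_eq_zero (p : ℕ) : (p : ZMod (p ^ 2)) ^ 2 = 0 := by
  rw [← Nat.cast_pow, ZMod.natCast_self]

theorem pow_pred_of_geom_sum_prime {p r n : ℕ} (hp : p.Prime) (hr : 2 ≤ r) (hn : 2 ≤ n)
    (h : ∑ i ∈ range n, r ^ i = p) :
    (r : ZMod (p ^ 2)) ^ (p - 1) = 1 + p * ((r - 1) * ((p - 1) / n) : ℕ) := by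
  have hd := dvd_pred_of_geom_sum_prime hp hr hn h
  have hpow := pred_mul_geom_sum_add_one (r := r) (by omega) n
  rw [h] at hpow
  have h1 : (r : ZMod (p ^ 2)) ^ n = 1 + p * ((r - 1 : ℕ) : ZMod (p ^ 2)) := by
    rw [← Nat.cast_pow, ← hpow, Nat.cast_add, Nat.cast_mul, Nat.cast_one]
    ring
  conv_lhs => rw [← Nat.mul_div_cancel' hd, pow_mul, h1,
    add_mul_pow_of_sq_eq_zero (natCast_self_sq_eq_zero p)]
  rw [Nat.cast_mul, one_pow, one_pow]
  ring

theorem dvd_two_mul_sum_add_one {p m c T : ℕ} (hp : p.Prime) (hp2 : Odd p)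
    (hm : 2 * m ^ 2 = 2 + p + p ^ 2 * c)
    (hT : ((m ^ 2 : ℕ) : ZMod (p ^ 2)) ^ (p - 1) = 1 + p * T) : p ∣ 2 * T + 1 := by
  have hε := natCast_self_sq_eq_zero p
  have h1 : (2 : ZMod (p ^ 2)) * ((m ^ 2 : ℕ) : ZMod (p ^ 2)) = 2 + p * 1 := by
    have := congrArg (Nat.cast : ℕ → ZMod (p ^ 2)) hm
    push_cast at this ⊢
    rw [this, hε]
    ring
  have h2 := congrArg (· ^ (p - 1)) h1
  simp only [mul_pow, hT, add_mul_pow_of_sq_eq_zero hε] at h2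
  have hp3 : 3 ≤ p := by
    have := hp.two_le
    obtain ⟨k, hk⟩ := hp2
    omega
  obtain ⟨k, rfl⟩ := Nat.exists_eq_add_of_le' hp3
  have h3 : ((2 ^ (k + 1) * ((k + 3) * (2 * T + 1)) : ℕ) : ZMod ((k + 3) ^ 2)) = 0 := by
    rw [show k + 3 - 1 = k + 2 by omega, show k + 2 - 1 = k + 1 by omega] at h2
    push_cast at h2 hε ⊢
    linear_combination h2 + 2 ^ (k + 1) * hε
  rw [ZMod.natCast_eq_zero_iff] at h3
  have hcop : Nat.Coprime ((k + 3) ^ 2) (2 ^ (k + 1)) :=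
    Nat.Coprime.pow _ _ hp2.coprime_two_right
  have h4 := hcop.dvd_of_dvd_mul_left h3
  rw [sq] at h4
  exact Nat.dvd_of_mul_dvd_mul_left (by omega) h4

theorem sigma_sq_eq_prod {m : ℕ} (hm : m ≠ 0) : ArithmeticFunction.sigma 1 (m ^ 2) =
    ∏ r ∈ m.primeFactors, ∑ i ∈ range (2 * m.factorization r + 1), r ^ i := by
  rw [ArithmeticFunction.isMultiplicative_sigma.multiplicative_factorization _
    (pow_ne_zero 2 hm), Finsupp.prod, Nat.support_factorization, Nat.primeFactors_pow m two_ne_zero]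
  refine prod_congr rfl fun r hr => ?_
  rw [ArithmeticFunction.sigma_one_apply_prime_pow (Nat.prime_of_mem_primeFactors hr),
    Nat.factorization_pow]
  rfl

theorem sigma_sq_ne_prime_pow {p b m : ℕ} (hp : p.Prime) (hp2 : Odd p) (hm : Odd m) (hb : 2 ≤ b)
    (h1 : 2 * m ^ 2 = ArithmeticFunction.sigma 1 (p ^ b) + 1) :
    ArithmeticFunction.sigma 1 (m ^ 2) ≠ p ^ b := by
  intro h2
  have hm0 : m ≠ 0 := by rintro rfl; simp at hm
  obtain ⟨c, hc⟩ : ∃ c, 2 * m ^ 2 = 2 + p + p ^ 2 * c := by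
    obtain ⟨d, rfl⟩ := Nat.exists_eq_add_of_le' hb
    rw [ArithmeticFunction.sigma_one_apply_prime_pow hp, sum_range_succ', sum_range_succ'] at h1
    refine ⟨∑ i ∈ range (d + 1), p ^ i, ?_⟩
    have hsq : ∑ i ∈ range (d + 1), p ^ (i + 1 + 1) = p ^ 2 * ∑ i ∈ range (d + 1), p ^ i := by
      rw [mul_sum]
      exact sum_congr rfl fun i _ => by ring
    rw [h1, hsq]
    ring
  rw [sigma_sq_eq_prod hm0] at h2
  set n : ℕ → ℕ := fun r => 2 * m.factorization r + 1 with hn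
  have hn3 : ∀ r ∈ m.primeFactors, 3 ≤ n r := fun r hr => by
    have := (Nat.prime_of_mem_primeFactors hr).factorization_pos_of_dvd hm0
      (Nat.dvd_of_mem_primeFactors hr)
    simp only [hn]
    omega
  have hr3 : ∀ r ∈ m.primeFactors, 3 ≤ r := fun r hr => by
    have h3 := (Nat.prime_of_mem_primeFactors hr).two_le
    have h4 : r ≠ 2 := by
      rintro rfl
      exact Nat.not_even_iff_odd.2 hm (even_iff_two_dvd.2 (Nat.dvd_of_mem_primeFactors hr))
    omega
  set S := m.primeFactors.filter fun r => ∑ i ∈ range (n r), r ^ i = p with hS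
  have hfam : RepunitFamily p n S := by
    have hsub : ∀ r ∈ S, r ∈ m.primeFactors := fun r hr => mem_of_mem_filter r hr
    have hsum : ∀ r ∈ S, ∑ i ∈ range (n r), r ^ i = p := fun r hr => (mem_filter.1 hr).2
    have h2r : ∀ r ∈ S, 2 ≤ r := fun r hr => by have := hr3 r (hsub r hr); omega
    have h2n : ∀ r ∈ S, 2 ≤ n r := fun r hr => by have := hn3 r (hsub r hr); omega
    exact
      { odd := hp2
        prime := fun r hr => Nat.prime_of_mem_primeFactors (hsub r hr)
        three_le := fun r hr => hr3 r (hsub r hr)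
        len_prime := fun r hr => prime_of_geom_sum_prime hp (h2r r hr) (h2n r hr) (hsum r hr)
        three_le_len := fun r hr => hn3 r (hsub r hr)
        sum_eq := hsum
        len_dvd := fun r hr => dvd_pred_of_geom_sum_prime hp (h2r r hr) (h2n r hr) (hsum r hr) }
  set τ : ℕ → ℕ := fun r => if r ∈ S then (n r - 1) * ((r - 1) * ((p - 1) / n r)) else 0 with hτ
  have hτr : ∀ r ∈ m.primeFactors,
      ((r : ZMod (p ^ 2)) ^ (p - 1)) ^ (n r - 1) = 1 + p * (τ r : ZMod (p ^ 2)) := by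
    intro r hr
    have hr2 : 2 ≤ r := by have := hr3 r hr; omega
    have hn2 : 2 ≤ n r := by have := hn3 r hr; omega
    by_cases hrS : r ∈ S
    · rw [pow_pred_of_geom_sum_prime hp hr2 hn2 (hfam.sum_eq r hrS),
        add_mul_pow_of_sq_eq_zero (natCast_self_sq_eq_zero p)]
      simp only [hτ, if_pos hrS, one_pow]
      push_cast
      ring
    · obtain ⟨j, -, hj⟩ := (Nat.dvd_prime_pow hp).1 (h2 ▸ dvd_prod_of_mem
        (fun r => ∑ i ∈ range (n r), r ^ i) hr)
      have hj2 : 2 ≤ j := by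
        by_contra! hj2
        interval_cases j
        · have := pow_lt_geom_sum (r := r) (k := 1) (n := n r) le_rfl (by omega)
          rw [hj, pow_zero, pow_one] at this
          omega
        · exact hrS (mem_filter.2 ⟨hr, by rw [hj, pow_one]⟩)
      rw [pow_pred_eq_one_of_geom_sum_eq_pow hp hp2 hr2 (by omega) hj2 hj]
      simp [hτ, if_neg hrS]
  have hmprod : m ^ 2 = ∏ r ∈ m.primeFactors, r ^ (n r - 1) := by
    conv_lhs => rw [← Nat.prod_factorization_pow_eq_self hm0]
    rw [Finsupp.prod, Nat.support_factorization, ← prod_pow]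
    refine prod_congr rfl fun r _ => ?_
    rw [← pow_mul, mul_comm]
    rfl
  have hT : ((m ^ 2 : ℕ) : ZMod (p ^ 2)) ^ (p - 1) = 1 + p * (∑ r ∈ S, τ r : ℕ) := by
    have hτsum : ∑ r ∈ S, τ r = ∑ r ∈ m.primeFactors, τ r :=
      sum_subset (filter_subset _ _) fun r _ hr => if_neg hr
    rw [hτsum, hmprod, Nat.cast_prod, ← prod_pow, Nat.cast_sum,
      ← prod_one_add_mul_of_sq_eq_zero (natCast_self_sq_eq_zero p)]
    refine prod_congr rfl fun r hr => ?_
    rw [← hτr r hr, Nat.cast_pow, ← pow_mul, ← pow_mul, mul_comm]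
  have hdvd := dvd_two_mul_sum_add_one hp hp2 hc hT
  rcases S.eq_empty_or_nonempty with hSe | hne
  · rw [hSe, sum_empty] at hdvd
    exact hp.one_lt.ne' (Nat.dvd_one.1 hdvd)
  have hlt := hfam.two_mul_sum_lt hne
  have hLτ : (∏ r ∈ S, n r) * ∑ r ∈ S, τ r =
      (p - 1) * ∑ r ∈ S, (r - 1) * ((n r - 1) * ∏ t ∈ S.erase r, n t) := by
    rw [mul_sum, mul_sum]
    refine sum_congr rfl fun r hr => ?_
    rw [← mul_prod_erase S n hr]
    simp only [hτ, if_pos hr]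
    conv_rhs => rw [← Nat.mul_div_cancel' (hfam.len_dvd r hr)]
    ring
  have hLW : ∏ r ∈ S, n r < 2 * ∑ r ∈ S, (r - 1) * ((n r - 1) * ∏ t ∈ S.erase r, n t) := by
    obtain ⟨r, hr⟩ := hne
    have h3 := single_le_sum (f := fun r => (r - 1) * ((n r - 1) * ∏ t ∈ S.erase r, n t))
      (fun _ _ => Nat.zero_le _) hr
    have hL0 : 0 < ∏ t ∈ S.erase r, n t := prod_pos fun t _ => Nat.succ_pos _
    rw [← mul_prod_erase S n hr]
    obtain ⟨x, hx⟩ := Nat.exists_eq_add_of_le' (hfam.three_le r hr)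
    obtain ⟨y, hy⟩ := Nat.exists_eq_add_of_le' (hfam.three_le_len r hr)
    generalize ∏ t ∈ S.erase r, n t = L at *
    generalize ∑ r ∈ S, (r - 1) * ((n r - 1) * ∏ t ∈ S.erase r, n t) = W at *
    rw [hy, hx] at h3
    rw [hy]
    rw [show x + 3 - 1 = x + 2 by omega, show y + 3 - 1 = y + 2 by omega] at h3
    nlinarith [Nat.zero_le (x * y * L), Nat.zero_le (x * L), Nat.zero_le (y * L)]
  have hdvd2 := Dvd.dvd.mul_left hdvd (∏ r ∈ S, n r)
  rw [mul_add, mul_left_comm, hLτ, mul_one] at hdvd2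
  generalize ∑ r ∈ S, (r - 1) * ((n r - 1) * ∏ t ∈ S.erase r, n t) = W at *
  generalize ∏ r ∈ S, n r = L at *
  have hd3 : p ∣ 2 * W - L := by
    obtain ⟨x, hx⟩ := Nat.exists_eq_add_of_le' hp.one_le
    have h5 : 2 * ((p - 1) * W) + L + (2 * W - L) = p * (2 * W) := by
      rw [hx, Nat.add_sub_cancel]
      have : L + (2 * W - L) = 2 * W := by omega
      nlinarith
    exact (Nat.dvd_add_right hdvd2).1 (h5 ▸ dvd_mul_right p _)
  have := Nat.le_of_dvd (by omega) hd3
  omega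

theorem two_mul_sub_one_mul_ne_three_pow {m k : ℕ} (hm : 2 ≤ m) :
    (2 * m - 1) * (2 * m + 1) ≠ 3 ^ k := by
  intro h
  obtain ⟨i, -, hi⟩ := (Nat.dvd_prime_pow Nat.prime_three).1 (Dvd.intro _ h)
  obtain ⟨j, -, hj⟩ := (Nat.dvd_prime_pow Nat.prime_three).1 (Dvd.intro_left _ h)
  rcases i with _ | i
  · rw [pow_zero] at hi
    omega
  rcases j with _ | j
  · rw [pow_zero] at hj
    omega
  rw [pow_succ] at hi hj
  omega

theorem eq_of_not_dvd_of_mul_eq {p b m q Q u w : ℕ} (hp : p.Prime) (hp3 : 3 ≤ p) (hm : Odd m)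
    (hQ : q + 1 = 2 * Q) (hpQ : ¬ p ∣ Q) (hpu : ¬ p ∣ u) (heq : Q * u * w = p ^ b * m ^ 2)
    (hσ : (p - 1) * (q * u) + 1 = p * p ^ b) (hlt : p ^ b * m ^ 2 < q ^ 2) :
    u = 1 ∧ w = p ^ b ∧ 2 * m ^ 2 = q + 1 := by
  have hcop : Nat.Coprime (p ^ b) (Q * u) :=
    Nat.Coprime.pow_left b ((Nat.Prime.coprime_iff_not_dvd hp).2 (hp.not_dvd_mul hpQ hpu))
  obtain ⟨k, rfl⟩ := hcop.dvd_of_dvd_mul_left (Dvd.intro _ heq.symm)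
  have hP : 0 < p ^ b := pow_pos hp.pos b
  have hm2 : Q * u * k = m ^ 2 := by
    refine Nat.eq_of_mul_eq_mul_left hP ?_
    rw [← heq]
    ring
  have hodd : Odd (Q * u * k) := hm2 ▸ hm.pow
  obtain ⟨hQu, hk⟩ := Nat.odd_mul.1 hodd
  obtain ⟨-, hu⟩ := Nat.odd_mul.1 hQu
  have h3P : 2 * (q * u) < 3 * p ^ b := by
    obtain ⟨x, rfl⟩ := Nat.exists_eq_add_of_le' hp3
    rw [show x + 3 - 1 = x + 2 by omega] at hσ
    generalize (x + 3) ^ b = P at *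
    by_contra! h
    nlinarith [Nat.zero_le (x * (q * u))]
  have hbound : u ^ 2 * k < 3 := by
    by_contra! h
    have h1 : 2 * (q * u) * (2 * (Q * u * k)) ≤ 3 * p ^ b * (2 * m ^ 2) := by
      rw [hm2]
      exact Nat.mul_le_mul_right _ h3P.le
    have h2 : 2 * (q * u) * (2 * (Q * u * k)) = 2 * q * (q + 1) * (u ^ 2 * k) := by
      rw [hQ]
      ring
    rw [h2] at h1
    have h4 := Nat.mul_le_mul_left (2 * q * (q + 1)) h
    nlinarith
  have hu1 : u = 1 := by
    have hkpos := hk.pos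
    have : u < 2 := by
      by_contra! h
      nlinarith
    have := hu.pos
    omega
  subst hu1
  have hk1 : k = 1 := by
    obtain ⟨x, rfl⟩ := hk
    omega
  subst hk1
  exact ⟨rfl, mul_one _, by rw [← hm2, hQ]; ring⟩

theorem not_dvd_of_mul_eq {p b m q Q u w : ℕ} (hp : p.Prime) (hp3 : 3 ≤ p) (hm : Odd m)
    (hpm : ¬ p ∣ m) (hQ : q + 1 = 2 * Q) (hpu : ¬ p ∣ u) (heq : Q * u * w = p ^ b * m ^ 2)
    (hσ : (p - 1) * (q * u) + 1 = p * p ^ b) (hlt : p ^ b * m ^ 2 < q ^ 2) : ¬ p ∣ Q := by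
  intro hpQ
  have hcube : ∀ x : ℕ, 2 * ((x + 3) * (x + 2)) ≤ (x + 3) ^ 3 := fun x => by
    nlinarith [Nat.zero_le (x ^ 3)]
  have hQ0 : Q ≠ 0 := by omega
  obtain ⟨s, t, hpt, rfl⟩ := Nat.exists_eq_pow_mul_and_not_dvd hQ0 p hp.ne_one
  have hs1 : 1 ≤ s := by
    by_contra! h
    rw [Nat.lt_one_iff.1 h, pow_zero, one_mul] at hpQ
    exact hpt hpQ
  have hsb : s ≤ b := by
    by_contra! h
    have h1 : p ^ b * p ∣ p ^ b * m ^ 2 := by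
      rw [← pow_succ, ← heq, mul_assoc, mul_assoc]
      exact (pow_dvd_pow p h).trans (dvd_mul_right _ _)
    exact hpm (hp.dvd_of_dvd_pow (Nat.dvd_of_mul_dvd_mul_left (pow_pos hp.pos b) h1))
  obtain ⟨d, rfl⟩ := Nat.exists_eq_add_of_le hsb
  have hS : 0 < p ^ s := pow_pos hp.pos s
  have hD : 0 < p ^ d := pow_pos hp.pos d
  have h1 : t * u * w = p ^ d * m ^ 2 := by
    refine Nat.eq_of_mul_eq_mul_left hS ?_
    rw [← mul_assoc (p ^ s) (p ^ d), ← pow_add, ← heq]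
    ring
  have hcop : Nat.Coprime (p ^ d) (t * u) :=
    Nat.Coprime.pow_left d ((Nat.Prime.coprime_iff_not_dvd hp).2 (hp.not_dvd_mul hpt hpu))
  obtain ⟨v, rfl⟩ := hcop.dvd_of_dvd_mul_left (Dvd.intro _ h1.symm)
  have hm2 : t * u * v = m ^ 2 := by
    refine Nat.eq_of_mul_eq_mul_left hD ?_
    rw [← h1]
    ring
  have hodd : Odd (t * u * v) := hm2 ▸ hm.pow
  obtain ⟨htu, hv⟩ := Nat.odd_mul.1 hodd
  obtain ⟨-, hu⟩ := Nat.odd_mul.1 htu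
  have hu0 := hu.pos
  have hv0 := hv.pos
  obtain ⟨c, hc, hc0⟩ : ∃ c, (p - 1) * u = 1 + p ^ s * c ∧ 0 < c := by
    have h2 : 2 ≤ (p - 1) * u := by
      have : 2 * 1 ≤ (p - 1) * u := Nat.mul_le_mul (by omega) hu0
      omega
    have h3 : p ^ s ∣ (p - 1) * u - 1 := by
      have h4 : (p - 1) * u * (q + 1) = p ^ s * (p * p ^ d) + ((p - 1) * u - 1) := by
        have : p ^ s * (p * p ^ d) = p * p ^ (s + d) := by rw [pow_add]; ring
        have h5 : (p - 1) * u * (q + 1) = (p - 1) * (q * u) + (p - 1) * u := by ring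
        rw [this, ← hσ, h5]
        omega
      refine (Nat.dvd_add_right (dvd_mul_right (p ^ s) (p * p ^ d))).1 ?_
      rw [← h4, hQ]
      exact ⟨(p - 1) * u * (2 * t), by ring⟩
    obtain ⟨c, hc⟩ := h3
    refine ⟨c, by omega, Nat.pos_of_ne_zero ?_⟩
    rintro rfl
    omega
  have huw : u * (p ^ d * v) < 2 * q := by
    have h2 : p ^ s * t * (u * (p ^ d * v)) < p ^ s * t * (2 * q) := by
      have h3 : p ^ s * t * (2 * q) = q ^ 2 + q := by
        calc _ = q * (2 * (p ^ s * t)) := by ring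
          _ = _ := by rw [← hQ]; ring
      calc _ = p ^ s * t * u * (p ^ d * v) := by ring
        _ < q ^ 2 := heq ▸ hlt
        _ ≤ _ := by
          rw [h3]
          exact Nat.le_add_right _ _
    exact Nat.lt_of_mul_lt_mul_left h2
  have hmain : ((p - 1) * u) ^ 2 * v < 2 * (p ^ s * (p * (p - 1))) := by
    have h2 : ((p - 1) * u) * (u * (p ^ d * v)) ≤ ((p - 1) * u) * (2 * q) :=
      Nat.mul_le_mul_left _ huw.le
    have h3 : p ^ d * ((p - 1) * u ^ 2 * v) < p ^ d * (2 * (p ^ s * p)) := by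
      have h4 : p ^ d * (2 * (p ^ s * p)) = 2 * (p * p ^ (s + d)) := by rw [pow_add]; ring
      rw [h4, ← hσ]
      nlinarith
    have h5 := Nat.lt_of_mul_lt_mul_left h3
    have h6 := Nat.mul_lt_mul_of_pos_left h5 (show 0 < p - 1 by omega)
    calc _ = (p - 1) * ((p - 1) * u ^ 2 * v) := by ring
      _ < _ := h6
      _ = _ := by ring
  rw [hc] at hmain
  have hbound : p ^ s * (c ^ 2 * v) < 2 * (p * (p - 1)) := by
    have h2 : p ^ s * (p ^ s * (c ^ 2 * v)) < p ^ s * (2 * (p * (p - 1))) := by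
      calc p ^ s * (p ^ s * (c ^ 2 * v)) = (p ^ s * c) ^ 2 * v := by ring
        _ ≤ (1 + p ^ s * c) ^ 2 * v := by gcongr; omega
        _ < _ := hmain
        _ = _ := by ring
    exact Nat.lt_of_mul_lt_mul_left h2
  have hcv : 0 < c ^ 2 * v := by positivity
  have hcd : p - 1 ∣ c + 1 := by
    have h2 : p - 1 ∣ 1 + p ^ s * c := hc ▸ dvd_mul_right _ _
    have h3 : p ^ s ≡ 1 [MOD p - 1] := by
      have h4 : p ≡ 1 [MOD p - 1] := ((Nat.modEq_iff_dvd' hp.one_le).2 dvd_rfl).symm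
      simpa using h4.pow s
    have h4 : 1 + p ^ s * c ≡ c + 1 [MOD p - 1] := by
      have := (h3.mul_right c).add_left 1
      rwa [one_mul, add_comm 1 c] at this
    exact (h4.dvd_iff dvd_rfl).1 h2
  have hcp := Nat.le_of_dvd (by omega) hcd
  obtain ⟨x, rfl⟩ := Nat.exists_eq_add_of_le' hp3
  rw [show x + 3 - 1 = x + 2 by omega] at *
  have hs2 : s < 3 := by
    by_contra! h
    have h2 : (x + 3) ^ 3 ≤ (x + 3) ^ s := Nat.pow_le_pow_right (by omega) h
    have h3 : (x + 3) ^ s ≤ (x + 3) ^ s * (c ^ 2 * v) := Nat.le_mul_of_pos_right _ hcv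
    exact absurd ((hcube x).trans (h2.trans h3)) hbound.not_ge
  interval_cases s
  · rw [pow_one, mul_left_comm 2] at hbound
    have h2 := Nat.lt_of_mul_lt_mul_left hbound
    have h3 : c ^ 2 < 2 * (x + 2) := lt_of_le_of_lt (Nat.le_mul_of_pos_right _ hv0) h2
    have hx : x < 2 := by
      by_contra! h
      nlinarith
    interval_cases x
    · have : c < 2 := by nlinarith
      obtain rfl : c = 1 := by omega
      obtain ⟨y, rfl⟩ := hu
      omega
    · exact absurd hp (by norm_num)
  · have h2 : (x + 3) * (c ^ 2 * v) < 2 * (x + 2) := by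
      refine Nat.lt_of_mul_lt_mul_left (a := x + 3) ?_
      calc _ = (x + 3) ^ 2 * (c ^ 2 * v) := by ring
        _ < _ := hbound
        _ = _ := by ring
    have h3 : c ^ 2 * v < 2 := by
      by_contra! h
      nlinarith
    have hc1 : c = 1 := by
      by_contra h
      have : 2 ≤ c := by omega
      nlinarith
    subst hc1
    have hv1 : v = 1 := by omega
    subst hv1
    have hx : x = 0 := by omega
    subst hx
    have hu5 : u = 5 := by omega
    subst hu5
    refine two_mul_sub_one_mul_ne_three_pow (m := m) (k := d + 1) ?_ ?_
    · by_contra! h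
      have : m = 0 ∨ m = 1 := by omega
      rcases this with rfl | rfl <;> omega
    · have h4 : (2 * m - 1) * (2 * m + 1) + 1 = 4 * m ^ 2 := by
        obtain ⟨y, rfl⟩ := Nat.exists_eq_add_of_le' hm.pos
        rw [show 2 * (y + 1) - 1 = 2 * y + 1 by omega]
        ring
      rw [show 2 + d = d + 1 + 1 by omega, pow_succ] at hσ
      norm_num at hσ hQ hm2
      omega

theorem not_lt_of_sigma_eq {q n : ℕ} (hq : q.Prime) (hq4 : q % 4 = 1) (hn : Odd n)
    (hgcd : Nat.Coprime q n)
    (h : ArithmeticFunction.sigma 1 (q * n ^ 2) = 2 * (q * n ^ 2)) : ¬ n < q := by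
  intro hnq
  have hn0 : n ≠ 0 := by rintro rfl; simp at hn
  have hmul := ArithmeticFunction.isMultiplicative_sigma (k := 1)
  have hσq : ArithmeticFunction.sigma 1 q = q + 1 := by
    have := ArithmeticFunction.sigma_one_apply_prime_pow (i := 1) hq
    rw [pow_one] at this
    rw [this, sum_range_succ, sum_range_one, pow_zero, pow_one, add_comm]
  rw [hmul.map_mul_of_coprime (hgcd.pow_right 2), hσq] at h
  have hqd : q ∣ ArithmeticFunction.sigma 1 (n ^ 2) := by
    refine Nat.Coprime.dvd_of_dvd_mul_left ?_ (⟨2 * n ^ 2, by rw [h]; ring⟩ : q ∣ (q + 1) * _)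
    simp
  rw [sigma_sq_eq_prod hn0, hq.prime.dvd_finsetProd_iff] at hqd
  obtain ⟨p, hpn, hqp⟩ := hqd
  have hp := Nat.prime_of_mem_primeFactors hpn
  have hpdvd := Nat.dvd_of_mem_primeFactors hpn
  have ha := hp.factorization_pos_of_dvd hn0 hpdvd
  have hp2 : Odd p := hn.of_dvd_nat hpdvd
  have hp3 : 3 ≤ p := by
    have := hp.two_le
    obtain ⟨k, hk⟩ := hp2
    omega
  have hnm := Nat.ordProj_mul_ordCompl_eq_self n p
  have hpm := Nat.not_dvd_ordCompl hp hn0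
  generalize n.factorization p = a at *
  generalize n / p ^ a = m at *
  have hm : Odd m := hn.of_dvd_nat (Dvd.intro_left _ hnm)
  obtain ⟨u, hu⟩ := hqp
  have hσp : ArithmeticFunction.sigma 1 (p ^ (2 * a)) = q * u := by
    rw [ArithmeticFunction.sigma_one_apply_prime_pow hp, hu]
  have hn2 : n ^ 2 = p ^ (2 * a) * m ^ 2 := by
    rw [← hnm]
    ring
  have hcop : Nat.Coprime (p ^ (2 * a)) (m ^ 2) :=
    Nat.Coprime.pow _ _ ((Nat.Prime.coprime_iff_not_dvd hp).2 hpm)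
  rw [hn2, hmul.map_mul_of_coprime hcop, hσp] at h
  obtain ⟨Q, hQ⟩ : ∃ Q, q + 1 = 2 * Q := ⟨(q + 1) / 2, by omega⟩
  have heq : Q * u * ArithmeticFunction.sigma 1 (m ^ 2) = p ^ (2 * a) * m ^ 2 := by
    refine Nat.eq_of_mul_eq_mul_left (show 0 < 2 * q by have := hq.pos; omega) ?_
    rw [hQ] at h
    linarith
  have hσ : (p - 1) * (q * u) + 1 = p * p ^ (2 * a) := by
    rw [← hu, pred_mul_geom_sum_add_one hp.one_le, pow_succ, mul_comm]
  have hpu : ¬ p ∣ u := by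
    intro hd
    have h1 : p ∣ (p - 1) * (q * u) + 1 := hσ ▸ dvd_mul_right _ _
    have h2 := (Nat.dvd_add_right ((hd.mul_left q).mul_left (p - 1))).1 h1
    exact hp.one_lt.ne' (Nat.dvd_one.1 h2)
  have hlt : p ^ (2 * a) * m ^ 2 < q ^ 2 := hn2 ▸ Nat.pow_lt_pow_left hnq two_ne_zero
  have hpQ := not_dvd_of_mul_eq hp hp3 hm hpm hQ hpu heq hσ hlt
  obtain ⟨rfl, hw, hmq⟩ := eq_of_not_dvd_of_mul_eq hp hp3 hm hQ hpQ hpu heq hσ hlt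
  exact sigma_sq_ne_prime_pow hp hp2 hm (b := 2 * a) (by omega)
    (by rw [hσp, hmq, mul_one]) hw

theorem stmt_14 (N q n : ℕ) (hodd : Odd N) (hperf : ArithmeticFunction.sigma 1 N = 2 * N)
    (hq : q.Prime) (hq4 : q % 4 = 1)
    (hgcd : Nat.gcd q n = 1) (hN : N = q * n ^ 2) (hnq : n < q) :
    (ArithmeticFunction.sigma 1 q : ℝ) / n < Real.sqrt 3 ∧
    (ArithmeticFunction.sigma 1 q : ℝ) / n + (ArithmeticFunction.sigma 1 n : ℝ) / q < 1 + Real.sqrt 3 := by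
  subst hN
  have hn : Odd n := hodd.of_dvd_nat ((dvd_pow_self n two_ne_zero).mul_left q)
  exact absurd hnq (not_lt_of_sigma_eq hq hq4 hn hgcd hperf)
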